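/- (Rakhmanov's theorem.) Let μ be a nontrivial probability measure on the unit circle with Lebesgue decomposition dμ = w(θ)·dθ/2π + dμ_s, where μ_s is singular with respect to dθ/2π. If w(θ) > 0 for Lebesgue-almost every θ (i.e., the essential support of the absolutely continuous part of μ is all of ∂𝔻), then the Verblunsky coefficients satisfy lim_{n→∞} α_n(dμ) = 0. -/

import Mathlib

open MeasureTheory Polynomial Filter

noncomputable section

/-- A nontrivial probability measure on the unit circle: a probability measure on `ℂ`
supported on `{z : ‖z‖ = 1}` that is not concentrated on any finite set
(equivalently, its support is infinite). -/
structure IsNontrivialOnCircle (μ : Measure ℂ) : Prop where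
  prob : IsProbabilityMeasure μ
  onCircle : μ {z : ℂ | ‖z‖ = 1}ᶜ = 0
  infiniteSupport : ∀ s : Finset ℂ, μ ((↑s : Set ℂ)ᶜ) ≠ 0

/-- `Φ` is the family of monic orthogonal polynomials for `μ`: each `Φ n` is monic of
degree `n` and orthogonal in `L²(∂𝔻, dμ)` to `z^j` for `j = 0, …, n-1`. -/
def IsMonicOPUC (μ : Measure ℂ) (Φ : ℕ → Polynomial ℂ) : Prop :=
  ∀ n : ℕ, ((Φ n).Monic ∧ (Φ n).natDegree = n) ∧
    ∀ j < n, ∫ z, (starRingEnd ℂ) z ^ j * (Φ n).eval z ∂μ = 0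

/-- Verblunsky coefficients: `α n = -conj (Φ (n+1) (0))`. -/
def verblunsky (Φ : ℕ → Polynomial ℂ) (n : ℕ) : ℂ :=
  - (starRingEnd ℂ) ((Φ (n + 1)).eval 0)

/-- Squared `L²(dμ)` norm of a polynomial. -/
def polyNormSq (μ : Measure ℂ) (P : Polynomial ℂ) : ℝ :=
  ∫ z, ‖P.eval z‖ ^ 2 ∂μ

/-- Orthonormal polynomial: `φ = Φ / ‖Φ‖_{L²(dμ)}`. -/
def orthonormalize (μ : Measure ℂ) (P : Polynomial ℂ) : Polynomial ℂ :=
  Polynomial.C ((Real.sqrt (polyNormSq μ P) : ℂ))⁻¹ * P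

/-- The reversed polynomial `P^{*,n}(z) = z^n conj (P (1/conj z))`. -/
def revStar (n : ℕ) (P : Polynomial ℂ) : Polynomial ℂ :=
  ∑ j ∈ Finset.range (n + 1),
    Polynomial.C ((starRingEnd ℂ) (P.coeff (n - j))) * Polynomial.X ^ j

/-- Normalized Lebesgue (arc-length) measure `dθ/2π` on the unit circle, as a measure on `ℂ`. -/
def lebCircle : Measure ℂ :=
  (ENNReal.ofReal (2 * Real.pi))⁻¹ •
    Measure.map (fun θ : ℝ => Complex.exp (Complex.I * θ))
      (volume.restrict (Set.Ioc 0 (2 * Real.pi)))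

/-- The reversed polynomial `z ^ n * conj (P (1 / conj z))`, as a polynomial. -/
def conjReverse (n : ℕ) (P : Polynomial ℂ) : Polynomial ℂ :=
  (P.reflect n).map (starRingEnd ℂ)

theorem conjReverse_eval {n : ℕ} {P : Polynomial ℂ} (hP : P.natDegree ≤ n) {z : ℂ} (hz : z ≠ 0) :
    (conjReverse n P).eval z = z ^ n * (starRingEnd ℂ) (P.eval ((starRingEnd ℂ) z)⁻¹) := by
  let _ : Invertible z⁻¹ := invertibleOfNonzero (inv_ne_zero hz)
  have h := eval₂_reflect_mul_pow (starRingEnd ℂ) z⁻¹ n P hP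
  rw [invOf_eq_inv, inv_inv, ← eval_map] at h
  have h2 : eval₂ (starRingEnd ℂ) z⁻¹ P
      = (starRingEnd ℂ) (P.eval ((starRingEnd ℂ) z)⁻¹) := by
    rw [Polynomial.eval, Polynomial.hom_eval₂]
    simp
  rw [conjReverse, ← h2, ← h, inv_pow]
  field_simp

theorem inv_conj_of_norm_eq_one {z : ℂ} (hz : ‖z‖ = 1) : ((starRingEnd ℂ) z)⁻¹ = z := by
  rw [Complex.inv_def, Complex.normSq_conj, Complex.normSq_eq_norm_sq, hz]
  simp

theorem mul_conj_of_norm_eq_one {z : ℂ} (hz : ‖z‖ = 1) : z * (starRingEnd ℂ) z = 1 := by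
  rw [Complex.mul_conj, Complex.normSq_eq_norm_sq, hz]
  simp

theorem conjReverse_eval_of_norm_eq_one {n : ℕ} {P : Polynomial ℂ} (hP : P.natDegree ≤ n) {z : ℂ}
    (hz : ‖z‖ = 1) : (conjReverse n P).eval z = z ^ n * (starRingEnd ℂ) (P.eval z) := by
  rw [conjReverse_eval hP (by rintro rfl; simp at hz), inv_conj_of_norm_eq_one hz]

theorem conjReverse_natDegree_le {n : ℕ} {P : Polynomial ℂ} (hP : P.natDegree ≤ n) :
    (conjReverse n P).natDegree ≤ n := by
  refine natDegree_map_le.trans ?_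
  rw [natDegree_le_iff_coeff_eq_zero]
  intro N hN
  rw [coeff_reflect, revAt_eq_self_of_lt hN]
  exact coeff_eq_zero_of_natDegree_lt (hP.trans_lt hN)

theorem conjReverse_eval_zero (n : ℕ) (P : Polynomial ℂ) :
    (conjReverse n P).eval 0 = (starRingEnd ℂ) (P.coeff n) := by
  rw [← coeff_zero_eq_eval_zero, conjReverse, coeff_map, coeff_reflect, revAt_zero]

section CircleMeasure

variable {ν : Measure ℂ} [IsFiniteMeasure ν]

theorem integrable_of_continuousOn_sphere {E : Type*} [NormedAddCommGroup E]
    (hν : ∀ᵐ z ∂ν, ‖z‖ = 1) {f : ℂ → E} (hf : ContinuousOn f {z | ‖z‖ = 1}) :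
    Integrable f ν := by
  have hs : {z : ℂ | ‖z‖ = 1} = Metric.sphere 0 1 := by ext; simp
  rw [hs] at hf
  have h := hf.integrableOn_compact (μ := ν) (isCompact_sphere 0 1)
  rwa [IntegrableOn, Measure.restrict_eq_self_of_ae_mem] at h
  simpa using hν

theorem integrable_of_continuous_of_ae_circle {E : Type*} [NormedAddCommGroup E]
    (hν : ∀ᵐ z ∂ν, ‖z‖ = 1) {f : ℂ → E} (hf : Continuous f) : Integrable f ν :=
  integrable_of_continuousOn_sphere hν hf.continuousOn

end CircleMeasure

theorem measurable_expI : Measurable (fun θ : ℝ => Complex.exp (Complex.I * θ)) := by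
  fun_prop

theorem lebCircle_ae_norm : ∀ᵐ z ∂lebCircle, ‖z‖ = 1 := by
  refine Measure.ae_smul_measure ?_ _
  rw [ae_map_iff measurable_expI.aemeasurable (measurableSet_eq_fun (by fun_prop) (by fun_prop))]
  refine Eventually.of_forall fun θ => ?_
  rw [mul_comm, Complex.norm_exp_ofReal_mul_I]

instance : IsProbabilityMeasure lebCircle := by
  constructor
  have h : (0 : ℝ) < 2 * Real.pi := by positivity
  rw [lebCircle, Measure.smul_apply, Measure.map_apply measurable_expI MeasurableSet.univ]
  simp only [Set.preimage_univ, Measure.restrict_apply_univ, Real.volume_Ioc, sub_zero, smul_eq_mul]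
  exact ENNReal.inv_mul_cancel (by simpa using h) ENNReal.ofReal_ne_top

/-- The mean value property with respect to `lebCircle`. -/
theorem integral_lebCircle_of_differentiableAt {f : ℂ → ℂ}
    (hf : ∀ z, ‖z‖ ≤ 1 → DifferentiableAt ℂ f z) : ∫ z, f z ∂lebCircle = f 0 := by
  have hc : ContinuousOn f {z | ‖z‖ = 1} := fun z hz =>
    (hf z (le_of_eq hz)).continuousAt.continuousWithinAt
  have hm := (integrable_of_continuousOn_sphere lebCircle_ae_norm hc).aestronglyMeasurable
  have hpi : (0 : ℝ) < 2 * Real.pi := by positivity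
  have hm' : AEStronglyMeasurable f (Measure.map (fun θ : ℝ => Complex.exp (Complex.I * θ))
      (volume.restrict (Set.Ioc 0 (2 * Real.pi)))) := by
    refine hm.mono_ac ?_
    rw [lebCircle]
    exact Measure.absolutelyContinuous_smul (ENNReal.inv_ne_zero.2 ENNReal.ofReal_ne_top)
  have hd : DiffContOnCl ℂ f (Metric.ball 0 |1|) := by
    refine DifferentiableOn.diffContOnCl fun z hz => (hf z ?_).differentiableWithinAt
    have := Metric.closure_ball_subset_closedBall hz
    simpa using this
  rw [← hd.circleAverage, Real.circleAverage_def, lebCircle, integral_smul_measure,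
    integral_map measurable_expI.aemeasurable hm', intervalIntegral.integral_of_le hpi.le,
    ENNReal.toReal_inv, ENNReal.toReal_ofReal hpi.le]
  simp [circleMap, mul_comm]

section Orthogonality

variable {μ : Measure ℂ} {Φ : ℕ → Polynomial ℂ}

theorem IsNontrivialOnCircle.ae_norm (hμ : IsNontrivialOnCircle μ) : ∀ᵐ z ∂μ, ‖z‖ = 1 :=
  hμ.onCircle

theorem IsNontrivialOnCircle.integrable_of_continuous (hμ : IsNontrivialOnCircle μ)
    {E : Type*} [NormedAddCommGroup E] {f : ℂ → E} (hf : Continuous f) : Integrable f μ :=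
  have := hμ.prob
  integrable_of_continuous_of_ae_circle hμ.ae_norm hf

theorem IsNontrivialOnCircle.eq_zero_of_integral_norm_sq (hμ : IsNontrivialOnCircle μ)
    {R : Polynomial ℂ} (hR : ∫ z, ‖R.eval z‖ ^ 2 ∂μ = 0) : R = 0 := by
  by_contra h0
  rw [integral_eq_zero_iff_of_nonneg (fun z => by positivity)
    (hμ.integrable_of_continuous (by fun_prop))] at hR
  refine hμ.infiniteSupport R.roots.toFinset ?_
  refine measure_mono_null ?_ hR
  intro z hz hz'
  apply hz
  simpa [h0] using hz'

theorem IsNontrivialOnCircle.integral_norm_sq_pos (hμ : IsNontrivialOnCircle μ)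
    {R : Polynomial ℂ} (hR : R ≠ 0) : 0 < ∫ z, ‖R.eval z‖ ^ 2 ∂μ :=
  lt_of_le_of_ne (integral_nonneg fun z => by positivity)
    fun h => hR (hμ.eq_zero_of_integral_norm_sq h.symm)

theorem IsNontrivialOnCircle.eq_zero_of_integral_conj_mul_self (hμ : IsNontrivialOnCircle μ)
    {R : Polynomial ℂ} (hR : ∫ z, (starRingEnd ℂ) (R.eval z) * R.eval z ∂μ = 0) : R = 0 := by
  apply hμ.eq_zero_of_integral_norm_sq
  have : ∀ z, (starRingEnd ℂ) (R.eval z) * R.eval z = ((‖R.eval z‖ ^ 2 : ℝ) : ℂ) := fun z => by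
    rw [mul_comm, Complex.mul_conj, Complex.normSq_eq_norm_sq]
  simp_rw [this] at hR
  rw [integral_complex_ofReal] at hR
  exact_mod_cast hR

theorem IsMonicOPUC.natDegree_eq (hΦ : IsMonicOPUC μ Φ) (n : ℕ) : (Φ n).natDegree = n :=
  (hΦ n).1.2

theorem IsMonicOPUC.coeff_self (hΦ : IsMonicOPUC μ Φ) (n : ℕ) : (Φ n).coeff n = 1 := by
  have h := (hΦ n).1.1
  rwa [Monic, leadingCoeff, hΦ.natDegree_eq] at h

theorem IsMonicOPUC.conjReverse_eval_zero (hΦ : IsMonicOPUC μ Φ) (n : ℕ) :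
    (conjReverse n (Φ n)).eval 0 = 1 := by
  rw [_root_.conjReverse_eval_zero, hΦ.coeff_self, map_one]

theorem IsMonicOPUC.integral_conj_mul (hμ : IsNontrivialOnCircle μ) (hΦ : IsMonicOPUC μ Φ)
    {n : ℕ} {R : Polynomial ℂ} (hR : R.degree < n) :
    ∫ z, (starRingEnd ℂ) (R.eval z) * (Φ n).eval z ∂μ = 0 := by
  rcases eq_or_ne R 0 with rfl | h0
  · simp
  have hn : R.natDegree < n := (natDegree_lt_iff_degree_lt h0).2 hR
  have h : ∀ z, (starRingEnd ℂ) (R.eval z) * (Φ n).eval z = ∑ i ∈ Finset.range n,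
      (starRingEnd ℂ) (R.coeff i) * ((starRingEnd ℂ) z ^ i * (Φ n).eval z) := fun z => by
    rw [eval_eq_sum_range' hn, map_sum, Finset.sum_mul]
    exact Finset.sum_congr rfl fun i _ => by rw [map_mul, map_pow, mul_assoc]
  simp_rw [h]
  rw [integral_finsetSum _ fun i _ => (hμ.integrable_of_continuous (by fun_prop))]
  refine Finset.sum_eq_zero fun i hi => ?_
  rw [integral_const_mul, (hΦ n).2 i (Finset.mem_range.1 hi), mul_zero]

/-- `Φ*_n` is orthogonal to `z, …, z ^ n`. -/
theorem IsMonicOPUC.integral_conj_mul_conjReverse (hμ : IsNontrivialOnCircle μ)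
    (hΦ : IsMonicOPUC μ Φ) {n : ℕ} {R : Polynomial ℂ} (hR : R.degree < n) :
    ∫ z, (starRingEnd ℂ) ((X * R).eval z) * (conjReverse n (Φ n)).eval z ∂μ = 0 := by
  rcases eq_or_ne R 0 with rfl | h0
  · simp
  have hn : R.natDegree < n := (natDegree_lt_iff_degree_lt h0).2 hR
  obtain ⟨m, rfl⟩ : ∃ m, n = m + 1 := ⟨n - 1, by omega⟩
  have hm : R.natDegree ≤ m := by omega
  have h : ∫ z, (starRingEnd ℂ) ((X * R).eval z) * (conjReverse (m + 1) (Φ (m + 1))).eval z ∂μ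
      = ∫ z, (starRingEnd ℂ)
        ((starRingEnd ℂ) ((conjReverse m R).eval z) * (Φ (m + 1)).eval z) ∂μ := by
    refine integral_congr_ae ?_
    filter_upwards [hμ.ae_norm] with z hz
    rw [conjReverse_eval_of_norm_eq_one hm hz,
      conjReverse_eval_of_norm_eq_one (hΦ.natDegree_eq _).le hz]
    simp only [eval_mul, eval_X, map_mul, map_pow, Complex.conj_conj]
    linear_combination (z ^ m * (starRingEnd ℂ) (R.eval z) *
      (starRingEnd ℂ) ((Φ (m + 1)).eval z)) * mul_conj_of_norm_eq_one hz
  rw [h, integral_conj, hΦ.integral_conj_mul hμ, map_zero]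
  refine degree_le_natDegree.trans_lt ?_
  exact_mod_cast Nat.lt_succ_of_le (conjReverse_natDegree_le hm)

/-- Szegő's recursion. -/
theorem IsMonicOPUC.szego_recursion (hμ : IsNontrivialOnCircle μ) (hΦ : IsMonicOPUC μ Φ) (n : ℕ) :
    Φ (n + 1) = X * Φ n - C ((starRingEnd ℂ) (verblunsky Φ n)) * conjReverse n (Φ n) := by
  set D := Φ (n + 1) - X * Φ n + C ((starRingEnd ℂ) (verblunsky Φ n)) * conjReverse n (Φ n)
    with hD
  suffices D = 0 by linear_combination this
  have hD0 : D.coeff 0 = 0 := by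
    rw [coeff_zero_eq_eval_zero, hD]
    simp [hΦ.conjReverse_eval_zero, verblunsky]
  have hDdeg : D.degree < (n + 1 : ℕ) := by
    rw [degree_lt_iff_coeff_zero]
    intro m hm
    have h1 : (conjReverse n (Φ n)).coeff m = 0 := coeff_eq_zero_of_natDegree_lt
      ((conjReverse_natDegree_le (hΦ.natDegree_eq n).le).trans_lt hm)
    obtain ⟨k, rfl⟩ : ∃ k, m = k + 1 := ⟨m - 1, by omega⟩
    rw [hD, coeff_add, coeff_sub, coeff_C_mul, h1, coeff_X_mul]
    rcases eq_or_lt_of_le (show n ≤ k by omega) with rfl | hk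
    · simp [hΦ.coeff_self]
    · rw [coeff_eq_zero_of_natDegree_lt (by rw [hΦ.natDegree_eq]; omega),
        coeff_eq_zero_of_natDegree_lt (by rw [hΦ.natDegree_eq]; omega)]
      simp
  have hDX : D = X * D.divX := by
    conv_lhs => rw [← X_mul_divX_add D, hD0]
    simp
  have hS : D.divX.degree < n := by
    rw [degree_lt_iff_coeff_zero] at hDdeg ⊢
    intro m hm
    rw [coeff_divX]
    exact hDdeg _ (by omega)
  apply hμ.eq_zero_of_integral_conj_mul_self
  have h1 : ∫ z, (starRingEnd ℂ) (D.eval z) * (Φ (n + 1)).eval z ∂μ = 0 :=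
    hΦ.integral_conj_mul hμ hDdeg
  have h2 : ∫ z, (starRingEnd ℂ) (D.eval z) * (X * Φ n).eval z ∂μ = 0 := by
    rw [← hΦ.integral_conj_mul hμ hS]
    refine integral_congr_ae ?_
    filter_upwards [hμ.ae_norm] with z hz
    rw [hDX]
    simp only [eval_mul, eval_X, map_mul]
    rw [← hDX]
    linear_combination ((starRingEnd ℂ) (D.divX.eval z) * (Φ n).eval z) *
      mul_conj_of_norm_eq_one hz
  have h3 : ∫ z, (starRingEnd ℂ) (D.eval z) * (conjReverse n (Φ n)).eval z ∂μ = 0 := by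
    rw [hDX]
    exact hΦ.integral_conj_mul_conjReverse hμ hS
  have h : ∀ z, (starRingEnd ℂ) (D.eval z) * D.eval z
      = (starRingEnd ℂ) (D.eval z) * (Φ (n + 1)).eval z
        - (starRingEnd ℂ) (D.eval z) * (X * Φ n).eval z
        + (starRingEnd ℂ) (verblunsky Φ n) *
          ((starRingEnd ℂ) (D.eval z) * (conjReverse n (Φ n)).eval z) := fun z => by
    have : D.eval z = (Φ (n + 1)).eval z - (X * Φ n).eval z
      + (starRingEnd ℂ) (verblunsky Φ n) * (conjReverse n (Φ n)).eval z := by simp [hD]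
    linear_combination (starRingEnd ℂ) (D.eval z) * this
  simp_rw [h]
  rw [integral_add (hμ.integrable_of_continuous (by fun_prop))
    (hμ.integrable_of_continuous (by fun_prop)),
    integral_sub (hμ.integrable_of_continuous (by fun_prop))
    (hμ.integrable_of_continuous (by fun_prop)), integral_const_mul, h1, h2, h3]
  simp

/-- Pythagoras for orthogonal polynomials in `L²(μ)`. -/
theorem IsNontrivialOnCircle.integral_norm_add_sq (hμ : IsNontrivialOnCircle μ)
    {P Q : Polynomial ℂ} (h : ∫ z, (starRingEnd ℂ) (P.eval z) * Q.eval z ∂μ = 0) :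
    ∫ z, ‖(P + Q).eval z‖ ^ 2 ∂μ = ∫ z, ‖P.eval z‖ ^ 2 ∂μ + ∫ z, ‖Q.eval z‖ ^ 2 ∂μ := by
  have h1 : ∀ z, ‖(P + Q).eval z‖ ^ 2 = ‖P.eval z‖ ^ 2 + ‖Q.eval z‖ ^ 2
      + 2 * ((starRingEnd ℂ) (P.eval z) * Q.eval z).re := fun z => by
    rw [eval_add, ← Complex.normSq_eq_norm_sq, ← Complex.normSq_eq_norm_sq,
      ← Complex.normSq_eq_norm_sq, Complex.normSq_add,
      ← Complex.conj_re (_ * _), map_mul, Complex.conj_conj]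
  have h2 : ∫ z, ((starRingEnd ℂ) (P.eval z) * Q.eval z).re ∂μ = 0 := by
    have := integral_re (𝕜 := ℂ) (μ := μ) (f := fun z => (starRingEnd ℂ) (P.eval z) * Q.eval z)
      (hμ.integrable_of_continuous (by fun_prop))
    rw [h] at this
    simpa using this
  simp_rw [h1]
  rw [integral_add (hμ.integrable_of_continuous (by fun_prop))
    (hμ.integrable_of_continuous (by fun_prop)),
    integral_add (hμ.integrable_of_continuous (by fun_prop))
    (hμ.integrable_of_continuous (by fun_prop)), integral_const_mul, h2]
  simp

theorem IsMonicOPUC.integral_norm_sq_pos (hμ : IsNontrivialOnCircle μ) (hΦ : IsMonicOPUC μ Φ)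
    (n : ℕ) : 0 < polyNormSq μ (Φ n) :=
  hμ.integral_norm_sq_pos (hΦ n).1.1.ne_zero

theorem IsMonicOPUC.norm_lt_one_of_isRoot (hμ : IsNontrivialOnCircle μ) (hΦ : IsMonicOPUC μ Φ)
    {n : ℕ} {x : ℂ} (hx : (Φ n).IsRoot x) : ‖x‖ < 1 := by
  obtain ⟨Q, hQ⟩ := dvd_iff_isRoot.2 hx
  have hΦ0 : Φ n ≠ 0 := (hΦ n).1.1.ne_zero
  have hQ0 : Q ≠ 0 := by rintro rfl; simp at hQ; exact hΦ0 hQ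
  have hdeg : Q.degree < n := by
    have h := congrArg natDegree hQ
    rw [natDegree_mul (X_sub_C_ne_zero x) hQ0, natDegree_X_sub_C, hΦ.natDegree_eq] at h
    exact (natDegree_lt_iff_degree_lt hQ0).1 (by omega)
  have horth : ∫ z, (starRingEnd ℂ) ((C x * Q).eval z) * (Φ n).eval z ∂μ = 0 := by
    apply hΦ.integral_conj_mul hμ
    rw [C_mul']
    exact (degree_smul_le x Q).trans_lt hdeg
  have hpy := hμ.integral_norm_add_sq horth
  have hsum : C x * Q + Φ n = X * Q := by rw [hQ]; ring
  rw [hsum] at hpy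
  have h1 : ∫ z, ‖(X * Q).eval z‖ ^ 2 ∂μ = ∫ z, ‖Q.eval z‖ ^ 2 ∂μ := by
    refine integral_congr_ae ?_
    filter_upwards [hμ.ae_norm] with z hz
    simp [hz]
  have h2 : ∫ z, ‖(C x * Q).eval z‖ ^ 2 ∂μ = ‖x‖ ^ 2 * ∫ z, ‖Q.eval z‖ ^ 2 ∂μ := by
    rw [← integral_const_mul]
    simp [mul_pow]
  have h3 := hμ.integral_norm_sq_pos hΦ0
  have h4 := hμ.integral_norm_sq_pos hQ0
  rw [h1, h2] at hpy
  by_contra! hcon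
  nlinarith [one_le_pow₀ (n := 2) hcon]

theorem IsMonicOPUC.conjReverse_eval_ne_zero (hμ : IsNontrivialOnCircle μ)
    (hΦ : IsMonicOPUC μ Φ) (n : ℕ) {z : ℂ} (hz : ‖z‖ ≤ 1) :
    (conjReverse n (Φ n)).eval z ≠ 0 := by
  rcases eq_or_ne z 0 with rfl | h0
  · rw [hΦ.conjReverse_eval_zero]
    exact one_ne_zero
  rw [conjReverse_eval (hΦ.natDegree_eq n).le h0]
  refine mul_ne_zero (pow_ne_zero _ h0) ((_root_.map_ne_zero _).2 fun h => ?_)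
  have h1 := hΦ.norm_lt_one_of_isRoot hμ h
  rw [norm_inv, RCLike.norm_conj] at h1
  exact absurd h1 (not_lt.2 (one_le_inv₀ (norm_pos_iff.2 h0) |>.2 hz))

theorem IsMonicOPUC.polyNormSq_succ (hμ : IsNontrivialOnCircle μ) (hΦ : IsMonicOPUC μ Φ)
    (n : ℕ) : polyNormSq μ (Φ (n + 1)) = (1 - ‖verblunsky Φ n‖ ^ 2) * polyNormSq μ (Φ n) := by
  have hle := conjReverse_natDegree_le (hΦ.natDegree_eq n).le
  have horth : ∫ z, (starRingEnd ℂ) ((C ((starRingEnd ℂ) (verblunsky Φ n)) *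
      conjReverse n (Φ n)).eval z) * (Φ (n + 1)).eval z ∂μ = 0 := by
    apply hΦ.integral_conj_mul hμ
    rw [C_mul']
    refine (degree_smul_le _ _).trans_lt (degree_le_natDegree.trans_lt ?_)
    exact_mod_cast Nat.lt_succ_of_le hle
  have hpy := hμ.integral_norm_add_sq horth
  rw [hΦ.szego_recursion hμ n, add_sub_cancel, ← hΦ.szego_recursion hμ n] at hpy
  have h1 : ∫ z, ‖(X * Φ n).eval z‖ ^ 2 ∂μ = polyNormSq μ (Φ n) := by
    refine integral_congr_ae ?_
    filter_upwards [hμ.ae_norm] with z hz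
    simp [hz]
  have h2 : ∫ z, ‖(C ((starRingEnd ℂ) (verblunsky Φ n)) * conjReverse n (Φ n)).eval z‖ ^ 2 ∂μ
      = ‖verblunsky Φ n‖ ^ 2 * polyNormSq μ (Φ n) := by
    rw [polyNormSq, ← integral_const_mul]
    refine integral_congr_ae ?_
    filter_upwards [hμ.ae_norm] with z hz
    simp [conjReverse_eval_of_norm_eq_one (hΦ.natDegree_eq n).le hz, hz, mul_pow]
  rw [h1, h2] at hpy
  simp only [polyNormSq] at hpy ⊢
  linarith

end Orthogonality

section BernsteinSzego

variable {μ : Measure ℂ} {Φ : ℕ → Polynomial ℂ}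

theorem integral_lebCircle_eval_div {P Q : Polynomial ℂ} (hQ : ∀ z, ‖z‖ ≤ 1 → Q.eval z ≠ 0) :
    ∫ z, P.eval z / Q.eval z ∂lebCircle = P.eval 0 / Q.eval 0 :=
  integral_lebCircle_of_differentiableAt fun z hz =>
    P.differentiable.differentiableAt.fun_div Q.differentiable.differentiableAt (hQ z hz)

theorem integrable_lebCircle_eval_div {P Q : Polynomial ℂ} (hQ : ∀ z, ‖z‖ ≤ 1 → Q.eval z ≠ 0) :
    Integrable (fun z => P.eval z / Q.eval z) lebCircle :=
  integrable_of_continuousOn_sphere lebCircle_ae_norm <|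
    P.continuous.continuousOn.div Q.continuous.continuousOn fun z hz => hQ z (le_of_eq hz)

theorem integrable_lebCircle_conj_eval_div {P Q : Polynomial ℂ}
    (hQ : ∀ z, ‖z‖ ≤ 1 → Q.eval z ≠ 0) :
    Integrable (fun z => (starRingEnd ℂ) (P.eval z / Q.eval z)) lebCircle :=
  integrable_of_continuousOn_sphere lebCircle_ae_norm <|
    Complex.continuous_conj.comp_continuousOn <|
    P.continuous.continuousOn.div Q.continuous.continuousOn fun z hz => hQ z (le_of_eq hz)

/-- The density `1 / |φ_n| ^ 2` of the `n`-th Bernstein–Szegő approximation of `μ`. -/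
def bernsteinSzego (μ : Measure ℂ) (Φ : ℕ → Polynomial ℂ) (n : ℕ) (z : ℂ) : ℝ :=
  polyNormSq μ (Φ n) / ‖(Φ n).eval z‖ ^ 2

theorem IsMonicOPUC.eval_ne_zero (hμ : IsNontrivialOnCircle μ) (hΦ : IsMonicOPUC μ Φ) (n : ℕ)
    {z : ℂ} (hz : ‖z‖ = 1) : (Φ n).eval z ≠ 0 := fun h =>
  absurd (hΦ.norm_lt_one_of_isRoot hμ h) (by simp [hz])

theorem bernsteinSzego_pos (hμ : IsNontrivialOnCircle μ) (hΦ : IsMonicOPUC μ Φ) (n : ℕ)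
    {z : ℂ} (hz : ‖z‖ = 1) : 0 < bernsteinSzego μ Φ n z :=
  div_pos (hΦ.integral_norm_sq_pos hμ n) (pow_pos (norm_pos_iff.2 (hΦ.eval_ne_zero hμ n hz)) 2)

theorem continuousOn_bernsteinSzego (hμ : IsNontrivialOnCircle μ) (hΦ : IsMonicOPUC μ Φ)
    (n : ℕ) : ContinuousOn (bernsteinSzego μ Φ n) {z | ‖z‖ = 1} :=
  ContinuousOn.div (by fun_prop) (by fun_prop)
    fun z hz => pow_ne_zero 2 (norm_ne_zero_iff.2 (hΦ.eval_ne_zero hμ n hz))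

theorem bernsteinSzego_eq_conjReverse (hΦ : IsMonicOPUC μ Φ) (n : ℕ) {z : ℂ} (hz : ‖z‖ = 1) :
    (bernsteinSzego μ Φ n z : ℂ) = polyNormSq μ (Φ n) /
      ((conjReverse n (Φ n)).eval z * (starRingEnd ℂ) ((conjReverse n (Φ n)).eval z)) := by
  have h : ‖(Φ n).eval z‖ = ‖(conjReverse n (Φ n)).eval z‖ := by
    rw [conjReverse_eval_of_norm_eq_one (hΦ.natDegree_eq n).le hz]
    simp [hz]
  rw [bernsteinSzego, h, Complex.mul_conj, Complex.normSq_eq_norm_sq]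
  push_cast
  rfl

theorem IsMonicOPUC.eval_eq_pow_mul_conj_conjReverse (hΦ : IsMonicOPUC μ Φ) (n : ℕ) {z : ℂ}
    (hz : ‖z‖ = 1) :
    (Φ n).eval z = z ^ n * (starRingEnd ℂ) ((conjReverse n (Φ n)).eval z) := by
  rw [conjReverse_eval_of_norm_eq_one (hΦ.natDegree_eq n).le hz, map_mul, map_pow,
    Complex.conj_conj, ← mul_assoc, ← mul_pow, mul_conj_of_norm_eq_one hz, one_pow, one_mul]

theorem IsMonicOPUC.conjReverse_succ_eval (hμ : IsNontrivialOnCircle μ) (hΦ : IsMonicOPUC μ Φ)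
    (n : ℕ) {z : ℂ} (hz : ‖z‖ = 1) :
    (conjReverse (n + 1) (Φ (n + 1))).eval z = (conjReverse n (Φ n)).eval z
      - verblunsky Φ n * z ^ (n + 1) *
        (starRingEnd ℂ) ((conjReverse n (Φ n)).eval z) := by
  have h := hΦ.eval_eq_pow_mul_conj_conjReverse n hz
  rw [conjReverse_eval_of_norm_eq_one (hΦ.natDegree_eq _).le hz, hΦ.szego_recursion hμ n]
  simp only [eval_sub, eval_mul, eval_X, eval_C, map_sub, map_mul, Complex.conj_conj]
  rw [h, map_mul, map_pow, Complex.conj_conj]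
  have h1 : z ^ (n + 1) * (starRingEnd ℂ) z ^ (n + 1) = 1 := by
    rw [← mul_pow, mul_conj_of_norm_eq_one hz, one_pow]
  linear_combination (eval z (conjReverse n (Φ n))) * h1

/-- The holomorphic function `u = α z Φ_n / Φ*_{n+1}`, for which
`|φ_n| ^ 2 / |φ_{n+1}| ^ 2 = 1 + u + conj u` on the circle. -/
def szegoQuotient (Φ : ℕ → Polynomial ℂ) (n : ℕ) (z : ℂ) : ℂ :=
  (C (verblunsky Φ n) * X * Φ n).eval z / (conjReverse (n + 1) (Φ (n + 1))).eval z

theorem szegoQuotient_eq (hΦ : IsMonicOPUC μ Φ) (n : ℕ) {z : ℂ} (hz : ‖z‖ = 1) :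
    szegoQuotient Φ n z = verblunsky Φ n * z ^ (n + 1) *
      (starRingEnd ℂ) ((conjReverse n (Φ n)).eval z) /
        (conjReverse (n + 1) (Φ (n + 1))).eval z := by
  rw [szegoQuotient]
  simp only [eval_mul, eval_C, eval_X]
  rw [hΦ.eval_eq_pow_mul_conj_conjReverse n hz]
  ring

theorem bernsteinSzego_succ (hμ : IsNontrivialOnCircle μ) (hΦ : IsMonicOPUC μ Φ) (n : ℕ) {z : ℂ}
    (hz : ‖z‖ = 1) : (bernsteinSzego μ Φ (n + 1) z : ℂ) = bernsteinSzego μ Φ n z *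
      (1 + szegoQuotient Φ n z + (starRingEnd ℂ) (szegoQuotient Φ n z)) := by
  have hG := hΦ.conjReverse_eval_ne_zero hμ n hz.le
  have hH := hΦ.conjReverse_eval_ne_zero hμ (n + 1) hz.le
  have hG' := (_root_.map_ne_zero (starRingEnd ℂ)).2 hG
  have hH' := (_root_.map_ne_zero (starRingEnd ℂ)).2 hH
  have hHG := hΦ.conjReverse_succ_eval hμ n hz
  have hHG' := congrArg (starRingEnd ℂ) hHG
  have h1 : z ^ (n + 1) * (starRingEnd ℂ) z ^ (n + 1) = 1 := by
    rw [← mul_pow, mul_conj_of_norm_eq_one hz, one_pow]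
  have hα : ((‖verblunsky Φ n‖ ^ 2 : ℝ) : ℂ)
      = verblunsky Φ n * (starRingEnd ℂ) (verblunsky Φ n) := by
    rw [Complex.mul_conj, Complex.normSq_eq_norm_sq]
  rw [bernsteinSzego_eq_conjReverse hΦ _ hz, bernsteinSzego_eq_conjReverse hΦ _ hz,
    szegoQuotient_eq hΦ n hz, hΦ.polyNormSq_succ hμ, Complex.ofReal_mul, Complex.ofReal_sub, hα,
    Complex.ofReal_one]
  simp only [map_div₀, map_mul, map_pow, map_sub, Complex.conj_conj] at hHG' ⊢
  set G := (conjReverse n (Φ n)).eval z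
  set H := (conjReverse (n + 1) (Φ (n + 1))).eval z
  set G' := (starRingEnd ℂ) G
  set H' := (starRingEnd ℂ) H
  set a := verblunsky Φ n
  set a' := (starRingEnd ℂ) a
  set t := z ^ (n + 1)
  set t' := (starRingEnd ℂ) z ^ (n + 1)
  field_simp
  rw [hHG, hHG']
  linear_combination (polyNormSq μ (Φ n) * a * a' * G * G') * h1

theorem integral_szegoQuotient (hμ : IsNontrivialOnCircle μ) (hΦ : IsMonicOPUC μ Φ) (n : ℕ) :
    ∫ z, szegoQuotient Φ n z ∂lebCircle = 0 := by
  simp only [szegoQuotient]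
  rw [integral_lebCircle_eval_div fun z hz => hΦ.conjReverse_eval_ne_zero hμ (n + 1) hz]
  simp

theorem integrable_szegoQuotient (hμ : IsNontrivialOnCircle μ) (hΦ : IsMonicOPUC μ Φ) (n : ℕ) :
    Integrable (szegoQuotient Φ n) lebCircle :=
  integrable_lebCircle_eval_div fun _ hz => hΦ.conjReverse_eval_ne_zero hμ (n + 1) hz

/-- The ratio `|φ_n| ^ 2 / |φ_{n+1}| ^ 2`. -/
def opucRatio (μ : Measure ℂ) (Φ : ℕ → Polynomial ℂ) (n : ℕ) (z : ℂ) : ℝ :=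
  bernsteinSzego μ Φ (n + 1) z / bernsteinSzego μ Φ n z

theorem opucRatio_eq (hμ : IsNontrivialOnCircle μ) (hΦ : IsMonicOPUC μ Φ) (n : ℕ) {z : ℂ}
    (hz : ‖z‖ = 1) : (opucRatio μ Φ n z : ℂ) =
      1 + szegoQuotient Φ n z + (starRingEnd ℂ) (szegoQuotient Φ n z) := by
  have h : (bernsteinSzego μ Φ n z : ℂ) ≠ 0 :=
    Complex.ofReal_ne_zero.2 (bernsteinSzego_pos hμ hΦ n hz).ne'
  rw [opucRatio, Complex.ofReal_div, bernsteinSzego_succ hμ hΦ n hz, mul_div_cancel_left₀ _ h]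

theorem continuousOn_opucRatio (hμ : IsNontrivialOnCircle μ) (hΦ : IsMonicOPUC μ Φ) (n : ℕ) :
    ContinuousOn (opucRatio μ Φ n) {z | ‖z‖ = 1} :=
  (continuousOn_bernsteinSzego hμ hΦ _).div (continuousOn_bernsteinSzego hμ hΦ _)
    fun _ hz => (bernsteinSzego_pos hμ hΦ n hz).ne'

theorem integral_opucRatio (hμ : IsNontrivialOnCircle μ) (hΦ : IsMonicOPUC μ Φ) (n : ℕ) :
    ∫ z, opucRatio μ Φ n z ∂lebCircle = 1 := by
  have h : ∫ z, (opucRatio μ Φ n z : ℂ) ∂lebCircle = ∫ z, (1 + szegoQuotient Φ n z +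
      (starRingEnd ℂ) (szegoQuotient Φ n z)) ∂lebCircle := by
    refine integral_congr_ae ?_
    filter_upwards [lebCircle_ae_norm] with z hz using opucRatio_eq hμ hΦ n hz
  have hi := integrable_szegoQuotient hμ hΦ n
  have hi' : Integrable (fun z => (starRingEnd ℂ) (szegoQuotient Φ n z)) lebCircle :=
    integrable_lebCircle_conj_eval_div fun _ hz => hΦ.conjReverse_eval_ne_zero hμ (n + 1) hz
  rw [integral_add ((integrable_const _).fun_add hi) hi', integral_add (integrable_const _) hi,
    integral_conj, integral_szegoQuotient hμ hΦ, integral_complex_ofReal] at h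
  simpa using h

/-- Rakhmanov's lemma. -/
theorem norm_verblunsky_le (hμ : IsNontrivialOnCircle μ) (hΦ : IsMonicOPUC μ Φ) (n : ℕ) :
    ‖verblunsky Φ n‖ ≤ ∫ z, |opucRatio μ Φ n z - 1| ∂lebCircle := by
  set s : ℂ → ℂ := fun z => (starRingEnd ℂ)
    ((X * Φ n).eval z / (conjReverse n (Φ n)).eval z) with hs
  have hs1 : ∀ z, ‖z‖ = 1 → ‖s z‖ = 1 := fun z hz => by
    have hG := hΦ.conjReverse_eval_ne_zero hμ n hz.le
    rw [hs]
    simp only [eval_mul, eval_X]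
    rw [hΦ.eval_eq_pow_mul_conj_conjReverse n hz]
    simp [hz, hG]
  have key : ∫ z, ((opucRatio μ Φ n z - 1 : ℝ) : ℂ) * s z ∂lebCircle = verblunsky Φ n := by
    have hH : ∀ z, ‖z‖ ≤ 1 → (conjReverse (n + 1) (Φ (n + 1))).eval z ≠ 0 :=
      fun z hz => hΦ.conjReverse_eval_ne_zero hμ (n + 1) hz
    have hHG : ∀ z, ‖z‖ ≤ 1 →
        (conjReverse (n + 1) (Φ (n + 1)) * conjReverse n (Φ n)).eval z ≠ 0 := fun z hz => by
      rw [eval_mul]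
      exact mul_ne_zero (hH z hz) (hΦ.conjReverse_eval_ne_zero hμ n hz)
    have h : ∫ z, ((opucRatio μ Φ n z - 1 : ℝ) : ℂ) * s z ∂lebCircle =
        ∫ z, ((C (verblunsky Φ n) * conjReverse n (Φ n)).eval z /
          (conjReverse (n + 1) (Φ (n + 1))).eval z + (starRingEnd ℂ)
          ((C (verblunsky Φ n) * X ^ 2 * Φ n ^ 2).eval z /
            (conjReverse (n + 1) (Φ (n + 1)) * conjReverse n (Φ n)).eval z)) ∂lebCircle := by
      refine integral_congr_ae ?_
      filter_upwards [lebCircle_ae_norm] with z hz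
      have hG := hΦ.conjReverse_eval_ne_zero hμ n hz.le
      have hH := hΦ.conjReverse_eval_ne_zero hμ (n + 1) hz.le
      have hG' := (_root_.map_ne_zero (starRingEnd ℂ)).2 hG
      have hH' := (_root_.map_ne_zero (starRingEnd ℂ)).2 hH
      have h1 : z ^ (n + 1) * (starRingEnd ℂ) z ^ (n + 1) = 1 := by
        rw [← mul_pow, mul_conj_of_norm_eq_one hz, one_pow]
      rw [Complex.ofReal_sub, opucRatio_eq hμ hΦ n hz, szegoQuotient_eq hΦ n hz, hs]
      simp only [eval_mul, eval_C, eval_X, eval_pow]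
      rw [hΦ.eval_eq_pow_mul_conj_conjReverse n hz]
      simp only [map_div₀, map_mul, map_pow, Complex.conj_conj, Complex.ofReal_one]
      field_simp
      linear_combination (verblunsky Φ n * (starRingEnd ℂ) ((conjReverse n (Φ n)).eval z) *
        (starRingEnd ℂ) ((conjReverse (n + 1) (Φ (n + 1))).eval z)) * h1
    rw [h, integral_add (integrable_lebCircle_eval_div hH)
      (integrable_lebCircle_conj_eval_div hHG), integral_conj, integral_lebCircle_eval_div hH,
      integral_lebCircle_eval_div hHG]
    simp [hΦ.conjReverse_eval_zero]
  rw [← key]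
  refine (norm_integral_le_integral_norm _).trans_eq (integral_congr_ae ?_)
  filter_upwards [lebCircle_ae_norm] with z hz
  rw [norm_mul, hs1 z hz, mul_one, Complex.norm_real, Real.norm_eq_abs]

theorem integrable_mul_bernsteinSzego (hμ : IsNontrivialOnCircle μ) (hΦ : IsMonicOPUC μ Φ)
    (n : ℕ) {f : ℂ → ℂ} (hf : Continuous f) :
    Integrable (fun z => f z * bernsteinSzego μ Φ n z) lebCircle :=
  integrable_of_continuousOn_sphere lebCircle_ae_norm <| hf.continuousOn.mul <|
    Complex.continuous_ofReal.comp_continuousOn (continuousOn_bernsteinSzego hμ hΦ n)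

theorem integral_pow_mul_bernsteinSzego_succ (hμ : IsNontrivialOnCircle μ)
    (hΦ : IsMonicOPUC μ Φ) {n k : ℕ} (hk : k ≤ n) :
    ∫ z, z ^ k * (bernsteinSzego μ Φ (n + 1) z : ℂ) ∂lebCircle =
      ∫ z, z ^ k * (bernsteinSzego μ Φ n z : ℂ) ∂lebCircle := by
  have hHG : ∀ z, ‖z‖ ≤ 1 →
      (conjReverse (n + 1) (Φ (n + 1)) * conjReverse n (Φ n)).eval z ≠ 0 := fun z hz => by
    rw [eval_mul]
    exact mul_ne_zero (hΦ.conjReverse_eval_ne_zero hμ (n + 1) hz)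
      (hΦ.conjReverse_eval_ne_zero hμ n hz)
  obtain ⟨m, rfl⟩ := Nat.exists_eq_add_of_le hk
  set c : ℂ := polyNormSq μ (Φ (k + m)) * verblunsky Φ (k + m) with hc
  have h : ∫ z, z ^ k * (bernsteinSzego μ Φ (k + m + 1) z : ℂ) ∂lebCircle =
      ∫ z, (z ^ k * (bernsteinSzego μ Φ (k + m) z : ℂ) +
        (C c * X ^ (k + m + 1 + k)).eval z /
          (conjReverse (k + m + 1) (Φ (k + m + 1)) * conjReverse (k + m) (Φ (k + m))).eval z +
        (starRingEnd ℂ) ((C c * X ^ (m + 1)).eval z /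
          (conjReverse (k + m + 1) (Φ (k + m + 1)) * conjReverse (k + m) (Φ (k + m))).eval z))
        ∂lebCircle := by
    refine integral_congr_ae ?_
    filter_upwards [lebCircle_ae_norm] with z hz
    have hG := hΦ.conjReverse_eval_ne_zero hμ (k + m) hz.le
    have hH := hΦ.conjReverse_eval_ne_zero hμ (k + m + 1) hz.le
    have hG' := (_root_.map_ne_zero (starRingEnd ℂ)).2 hG
    have hH' := (_root_.map_ne_zero (starRingEnd ℂ)).2 hH
    have h1 : z ^ k * (starRingEnd ℂ) z ^ k = 1 := by
      rw [← mul_pow, mul_conj_of_norm_eq_one hz, one_pow]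
    rw [bernsteinSzego_succ hμ hΦ _ hz, szegoQuotient_eq hΦ _ hz,
      bernsteinSzego_eq_conjReverse hΦ _ hz]
    simp only [eval_mul, eval_C, eval_X, eval_pow, map_div₀, map_mul, map_pow, Complex.conj_conj,
      hc, Complex.conj_ofReal]
    field_simp
    linear_combination (polyNormSq μ (Φ (k + m)) * (starRingEnd ℂ) z ^ (m + 1) * (starRingEnd ℂ) (verblunsky Φ (k + m)) *
      (conjReverse (k + m + 1) (Φ (k + m + 1))).eval z *
      (conjReverse (k + m) (Φ (k + m))).eval z) * h1
  rw [h, integral_add ((integrable_mul_bernsteinSzego hμ hΦ _ (by fun_prop)).fun_add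
      (integrable_lebCircle_eval_div hHG)) (integrable_lebCircle_conj_eval_div hHG),
    integral_add (integrable_mul_bernsteinSzego hμ hΦ _ (by fun_prop))
      (integrable_lebCircle_eval_div hHG), integral_conj, integral_lebCircle_eval_div hHG,
    integral_lebCircle_eval_div hHG]
  simp

theorem integral_eval_mul_bernsteinSzego_self (hμ : IsNontrivialOnCircle μ)
    (hΦ : IsMonicOPUC μ Φ) (n : ℕ) :
    ∫ z, (Φ (n + 1)).eval z * (bernsteinSzego μ Φ (n + 1) z : ℂ) ∂lebCircle = 0 := by
  have hH : ∀ z, ‖z‖ ≤ 1 → (conjReverse (n + 1) (Φ (n + 1))).eval z ≠ 0 :=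
    fun z hz => hΦ.conjReverse_eval_ne_zero hμ (n + 1) hz
  have h : ∫ z, (Φ (n + 1)).eval z * (bernsteinSzego μ Φ (n + 1) z : ℂ) ∂lebCircle =
      ∫ z, (C (polyNormSq μ (Φ (n + 1)) : ℂ) * X ^ (n + 1)).eval z /
        (conjReverse (n + 1) (Φ (n + 1))).eval z ∂lebCircle := by
    refine integral_congr_ae ?_
    filter_upwards [lebCircle_ae_norm] with z hz
    have hG' := (_root_.map_ne_zero (starRingEnd ℂ)).2 (hH z hz.le)
    have hG := hH z hz.le
    rw [bernsteinSzego_eq_conjReverse hΦ _ hz, hΦ.eval_eq_pow_mul_conj_conjReverse _ hz]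
    simp only [eval_mul, eval_C, eval_X, eval_pow]
    field_simp
  rw [h, integral_lebCircle_eval_div hH]
  simp

/-- The Bernstein–Szegő approximations have the same first moments as `μ`. -/
theorem integral_pow_mul_bernsteinSzego (hμ : IsNontrivialOnCircle μ) (hΦ : IsMonicOPUC μ Φ)
    (n : ℕ) : ∀ k ≤ n, ∫ z, z ^ k * (bernsteinSzego μ Φ n z : ℂ) ∂lebCircle = ∫ z, z ^ k ∂μ := by
  have := hμ.prob
  induction n with
  | zero =>
    intro k hk
    have h0 : Φ 0 = 1 := Monic.natDegree_eq_zero (hΦ 0).1.1 |>.1 (hΦ 0).1.2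
    obtain rfl : k = 0 := by omega
    simp [bernsteinSzego, polyNormSq, h0]
  | succ n ih =>
    have hlow : ∀ k ≤ n, ∫ z, z ^ k * (bernsteinSzego μ Φ (n + 1) z : ℂ) ∂lebCircle
        = ∫ z, z ^ k ∂μ := fun k hk => by
      rw [integral_pow_mul_bernsteinSzego_succ hμ hΦ hk, ih k hk]
    intro k hk
    rcases Nat.lt_or_ge k (n + 1) with h | h
    · exact hlow k (by omega)
    obtain rfl : k = n + 1 := by omega
    have he : ∀ z, (Φ (n + 1)).eval z
        = (∑ i ∈ Finset.range (n + 1), (Φ (n + 1)).coeff i * z ^ i) + z ^ (n + 1) := fun z => by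
      rw [eval_eq_sum_range, hΦ.natDegree_eq, Finset.sum_range_succ, hΦ.coeff_self, one_mul]
    have h1 := integral_eval_mul_bernsteinSzego_self hμ hΦ n
    have h2 : ∫ z, (Φ (n + 1)).eval z ∂μ = 0 := by
      simpa using (hΦ (n + 1)).2 0 (Nat.succ_pos n)
    simp_rw [he] at h1 h2
    simp_rw [add_mul, Finset.sum_mul, mul_assoc] at h1
    have hi : ∀ i, Integrable (fun z => z ^ i * (bernsteinSzego μ Φ (n + 1) z : ℂ)) lebCircle :=
      fun i => integrable_mul_bernsteinSzego hμ hΦ _ (by fun_prop)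
    have hi' : ∀ i, Integrable (fun z : ℂ => z ^ i) μ :=
      fun i => hμ.integrable_of_continuous (by fun_prop)
    rw [integral_add (integrable_finsetSum _ fun i _ => (hi i).const_mul _) (hi _),
      integral_finsetSum _ fun i _ => (hi i).const_mul _] at h1
    rw [integral_add (integrable_finsetSum _ fun i _ => (hi' i).const_mul _) (hi' _),
      integral_finsetSum _ fun i _ => (hi' i).const_mul _] at h2
    simp_rw [integral_const_mul] at h1 h2
    rw [Finset.sum_congr rfl fun i hi => by
      rw [hlow i (Nat.lt_succ_iff.1 (Finset.mem_range.1 hi))]] at h1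
    linear_combination h1 - h2

theorem integral_pow_mul_conj_pow_mul_bernsteinSzego (hμ : IsNontrivialOnCircle μ)
    (hΦ : IsMonicOPUC μ Φ) {n i j : ℕ} (hi : i ≤ n) (hj : j ≤ n) :
    ∫ z, z ^ i * (starRingEnd ℂ) z ^ j * (bernsteinSzego μ Φ n z : ℂ) ∂lebCircle
      = ∫ z, z ^ i * (starRingEnd ℂ) z ^ j ∂μ := by
  have hpow : ∀ a b : ℕ, ∀ z : ℂ, ‖z‖ = 1 →
      z ^ (a + b) * (starRingEnd ℂ) z ^ a = z ^ b := fun a b z hz => by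
    rw [pow_add, mul_right_comm, ← mul_pow, mul_conj_of_norm_eq_one hz, one_pow, one_mul]
  rcases le_total j i with h | h
  · obtain ⟨m, rfl⟩ := Nat.exists_eq_add_of_le h
    have h1 := integral_pow_mul_bernsteinSzego hμ hΦ n m (by omega)
    calc _ = ∫ z, z ^ m * (bernsteinSzego μ Φ n z : ℂ) ∂lebCircle := integral_congr_ae <| by
          filter_upwards [lebCircle_ae_norm] with z hz
          rw [hpow j m z hz]
      _ = ∫ z, z ^ m ∂μ := h1
      _ = _ := integral_congr_ae <| by
          filter_upwards [hμ.ae_norm] with z hz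
          rw [hpow j m z hz]
  · obtain ⟨m, rfl⟩ := Nat.exists_eq_add_of_le h
    have h1 := congrArg (starRingEnd ℂ) (integral_pow_mul_bernsteinSzego hμ hΦ n m (by omega))
    rw [← integral_conj, ← integral_conj] at h1
    have hpow' : ∀ z : ℂ, ‖z‖ = 1 →
        z ^ i * (starRingEnd ℂ) z ^ (i + m) = (starRingEnd ℂ) (z ^ m) := fun z hz => by
      have := congrArg (starRingEnd ℂ) (hpow i m z hz)
      rw [map_mul, map_pow, map_pow, Complex.conj_conj] at this
      rw [← this, mul_comm]
    calc _ = ∫ z, (starRingEnd ℂ) (z ^ m * (bernsteinSzego μ Φ n z : ℂ)) ∂lebCircle :=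
          integral_congr_ae <| by
          filter_upwards [lebCircle_ae_norm] with z hz
          rw [hpow' z hz, map_mul, Complex.conj_ofReal]
      _ = ∫ z, (starRingEnd ℂ) (z ^ m) ∂μ := h1
      _ = _ := integral_congr_ae <| by
          filter_upwards [hμ.ae_norm] with z hz
          rw [hpow' z hz]

theorem integral_norm_sq_mul_bernsteinSzego (hμ : IsNontrivialOnCircle μ)
    (hΦ : IsMonicOPUC μ Φ) {n : ℕ} {P : Polynomial ℂ} (hP : P.natDegree ≤ n) :
    ∫ z, ‖P.eval z‖ ^ 2 * bernsteinSzego μ Φ n z ∂lebCircle = ∫ z, ‖P.eval z‖ ^ 2 ∂μ := by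
  have he : ∀ z, ((‖P.eval z‖ ^ 2 : ℝ) : ℂ) = ∑ i ∈ Finset.range (n + 1),
      ∑ j ∈ Finset.range (n + 1), (P.coeff i * (starRingEnd ℂ) (P.coeff j)) *
        (z ^ i * (starRingEnd ℂ) z ^ j) := fun z => by
    rw [← Complex.normSq_eq_norm_sq, ← Complex.mul_conj,
      eval_eq_sum_range' (Nat.lt_succ_of_le hP), map_sum, Finset.sum_mul_sum]
    refine Finset.sum_congr rfl fun i _ => Finset.sum_congr rfl fun j _ => ?_
    rw [map_mul, map_pow]
    ring
  apply Complex.ofReal_injective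
  rw [← integral_complex_ofReal, ← integral_complex_ofReal]
  simp_rw [Complex.ofReal_mul, he, Finset.sum_mul, mul_assoc]
  have hi : ∀ i j, Integrable (fun z => z ^ i * ((starRingEnd ℂ) z ^ j *
      (bernsteinSzego μ Φ n z : ℂ))) lebCircle := fun i j => by
    simp_rw [← mul_assoc]
    exact integrable_mul_bernsteinSzego hμ hΦ _ (by fun_prop)
  have hi' : ∀ i j, Integrable (fun z : ℂ => z ^ i * (starRingEnd ℂ) z ^ j) μ :=
    fun i j => hμ.integrable_of_continuous (by fun_prop)
  rw [integral_finsetSum _ fun i _ => integrable_finsetSum _ fun j _ =>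
      ((hi i j).const_mul _).const_mul _,
    integral_finsetSum _ fun i _ => integrable_finsetSum _ fun j _ =>
      ((hi' i j).const_mul _).const_mul _]
  refine Finset.sum_congr rfl fun i hin => ?_
  rw [integral_finsetSum _ fun j _ => ((hi i j).const_mul _).const_mul _,
    integral_finsetSum _ fun j _ => ((hi' i j).const_mul _).const_mul _]
  refine Finset.sum_congr rfl fun j hjn => ?_
  simp_rw [integral_const_mul, ← integral_pow_mul_conj_pow_mul_bernsteinSzego hμ hΦ
    (Nat.lt_succ_iff.1 (Finset.mem_range.1 hin)) (Nat.lt_succ_iff.1 (Finset.mem_range.1 hjn)),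
    mul_assoc]

end BernsteinSzego

section Approximation

theorem exists_polynomial_of_mem_adjoin_id {f : C(Metric.sphere (0 : ℂ) 1, ℂ)}
    (hf : f ∈ StarAlgebra.adjoin ℂ
      {ContinuousMap.restrict (Metric.sphere (0 : ℂ) 1) (ContinuousMap.id ℂ)}) :
    ∃ (k : ℕ) (P : Polynomial ℂ), ∀ z : Metric.sphere (0 : ℂ) 1,
      (z : ℂ) ^ k * f z = P.eval (z : ℂ) := by
  induction hf using StarAlgebra.adjoin_induction with
  | mem x hx =>
    obtain rfl := Set.mem_singleton_iff.1 hx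
    exact ⟨0, X, fun z => by simp⟩
  | algebraMap r => exact ⟨0, C r, fun z => by simp⟩
  | add f g _ _ hf hg =>
    obtain ⟨k, P, hP⟩ := hf
    obtain ⟨l, Q, hQ⟩ := hg
    refine ⟨k + l, X ^ l * P + X ^ k * Q, fun z => ?_⟩
    simp only [ContinuousMap.add_apply, eval_add, eval_mul, eval_pow, eval_X, ← hP, ← hQ]
    ring
  | mul f g _ _ hf hg =>
    obtain ⟨k, P, hP⟩ := hf
    obtain ⟨l, Q, hQ⟩ := hg
    refine ⟨k + l, P * Q, fun z => ?_⟩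
    simp only [ContinuousMap.mul_apply, eval_mul, ← hP, ← hQ]
    ring
  | star f _ hf =>
    obtain ⟨k, P, hP⟩ := hf
    refine ⟨P.natDegree, X ^ k * conjReverse P.natDegree P, fun z => ?_⟩
    have hz : ‖(z : ℂ)‖ = 1 := by simp
    have h1 : (z : ℂ) ^ k * (starRingEnd ℂ) (z : ℂ) ^ k = 1 := by
      rw [← mul_pow, mul_conj_of_norm_eq_one hz, one_pow]
    rw [eval_mul, conjReverse_eval_of_norm_eq_one le_rfl hz, ← hP, ContinuousMap.star_apply,
      ← starRingEnd_apply]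
    simp only [eval_pow, eval_X, map_mul, map_pow]
    linear_combination (-(z : ℂ) ^ P.natDegree * (starRingEnd ℂ) (f z)) * h1

/-- Laurent polynomials are uniformly dense in the continuous functions on the circle. -/
theorem exists_laurent_approx {g : ℂ → ℂ} (hg : Continuous g) {δ : ℝ} (hδ : 0 < δ) :
    ∃ (k : ℕ) (P : Polynomial ℂ), ∀ z : ℂ, ‖z‖ = 1 →
      ‖g z - (starRingEnd ℂ) z ^ k * P.eval z‖ ≤ δ := by
  let g' : C(Metric.sphere (0 : ℂ) 1, ℂ) := ContinuousMap.restrict _ ⟨g, hg⟩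
  have hmem : g' ∈ StarAlgebra.elemental ℂ
      (ContinuousMap.restrict (Metric.sphere (0 : ℂ) 1) (ContinuousMap.id ℂ)) := by
    rw [ContinuousMap.elemental_id_eq_top]
    exact StarSubalgebra.mem_top
  have hcl : g' ∈ closure (StarAlgebra.adjoin ℂ
      {ContinuousMap.restrict (Metric.sphere (0 : ℂ) 1) (ContinuousMap.id ℂ)} :
        Set C(Metric.sphere (0 : ℂ) 1, ℂ)) := hmem
  obtain ⟨f, hf, hfg⟩ := Metric.mem_closure_iff.1 hcl δ hδ
  obtain ⟨k, P, hP⟩ := exists_polynomial_of_mem_adjoin_id hf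
  refine ⟨k, P, fun z hz => ?_⟩
  have h1 : z ^ k * (starRingEnd ℂ) z ^ k = 1 := by
    rw [← mul_pow, mul_conj_of_norm_eq_one hz, one_pow]
  let z' : Metric.sphere (0 : ℂ) 1 := ⟨z, by simpa using hz⟩
  have h2 : (starRingEnd ℂ) z ^ k * P.eval z = f z' := by
    rw [← hP z']
    change (starRingEnd ℂ) z ^ k * (z ^ k * f z') = f z'
    linear_combination f z' * h1
  rw [h2, ← dist_eq_norm]
  exact (ContinuousMap.dist_apply_le_dist z').trans hfg.le

/-- Laurent polynomials are dense in `L²` of the circle. -/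
theorem exists_laurent_approx_memLp {ν : Measure ℂ} [IsProbabilityMeasure ν]
    (hν : ∀ᵐ z ∂ν, ‖z‖ = 1) {f : ℂ → ℂ} (hf : MemLp f 2 ν) {ε : ℝ} (hε : 0 < ε) :
    ∃ (k : ℕ) (P : Polynomial ℂ),
      ∫ z, ‖f z - (starRingEnd ℂ) z ^ k * P.eval z‖ ^ 2 ∂ν ≤ ε := by
  obtain ⟨g, hg, hgm⟩ := MemLp.exists_boundedContinuous_integral_rpow_sub_le (p := 2) (by norm_num)
    (by simpa using hf) (show 0 < ε / 4 by positivity)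
  obtain ⟨k, P, hP⟩ := exists_laurent_approx g.continuous (show 0 < √(ε / 4) by positivity)
  refine ⟨k, P, ?_⟩
  have hgm : MemLp g 2 ν := by simpa using hgm
  have hi := (memLp_two_iff_integrable_sq_norm (hf.sub hgm).1).1 (hf.sub hgm)
  simp only [Pi.sub_apply] at hi
  have hg' : ∫ z, ‖f z - g z‖ ^ 2 ∂ν ≤ ε / 4 := by
    simpa using hg
  calc ∫ z, ‖f z - (starRingEnd ℂ) z ^ k * P.eval z‖ ^ 2 ∂ν
      ≤ ∫ z, (2 * ‖f z - g z‖ ^ 2 + ε / 2) ∂ν := by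
        refine integral_mono_of_nonneg (Eventually.of_forall fun z => by positivity)
          ((hi.const_mul 2).fun_add (integrable_const _)) ?_
        filter_upwards [hν] with z hz
        have h1 := hP z hz
        have h2 : ‖f z - (starRingEnd ℂ) z ^ k * P.eval z‖ ≤ ‖f z - g z‖ + √(ε / 4) := by
          refine (norm_sub_le_norm_sub_add_norm_sub _ (g z) _).trans ?_
          gcongr
        have h3 := Real.sq_sqrt (show 0 ≤ ε / 4 by positivity)
        have h4 := pow_le_pow_left₀ (norm_nonneg _) h2 2
        nlinarith [sq_nonneg (‖f z - g z‖ - √(ε / 4))]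
    _ = 2 * ∫ z, ‖f z - g z‖ ^ 2 ∂ν + ε / 2 := by
        rw [integral_add (hi.const_mul 2) (integrable_const _), integral_const_mul]
        simp
    _ ≤ ε := by linarith

end Approximation

section Rakhmanov

variable {μ μs : Measure ℂ} {w : ℂ → ℝ}

theorem integrable_mul_weight (hw : Measurable w) (hw0 : ∀ z, 0 ≤ w z)
    (hdecomp : μ = lebCircle.withDensity (fun z => ENNReal.ofReal (w z)) + μs)
    {g : ℂ → ℝ} (hg : Integrable g μ) : Integrable (fun z => w z * g z) lebCircle := by
  rw [hdecomp] at hg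
  have h := (integrable_withDensity_iff_integrable_smul' hw.ennreal_ofReal
    (Eventually.of_forall fun z => ENNReal.ofReal_lt_top)).1 hg.left_of_add_measure
  simpa [ENNReal.toReal_ofReal (hw0 _)] using h

theorem integral_mul_weight_le (hw : Measurable w) (hw0 : ∀ z, 0 ≤ w z)
    (hdecomp : μ = lebCircle.withDensity (fun z => ENNReal.ofReal (w z)) + μs)
    {g : ℂ → ℝ} (hg : Integrable g μ) (hg0 : ∀ z, 0 ≤ g z) :
    ∫ z, w z * g z ∂lebCircle ≤ ∫ z, g z ∂μ := by
  have h : ∫ z, w z * g z ∂lebCircle =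
      ∫ z, g z ∂(lebCircle.withDensity fun z => ENNReal.ofReal (w z)) := by
    rw [integral_withDensity_eq_integral_toReal_smul hw.ennreal_ofReal
      (Eventually.of_forall fun z => ENNReal.ofReal_lt_top)]
    simp [ENNReal.toReal_ofReal (hw0 _)]
  rw [h]
  refine integral_mono_measure ?_ (Eventually.of_forall hg0) hg
  rw [hdecomp]
  exact Measure.le_add_right le_rfl

theorem exists_sqrt_weight_inv (hw : Measurable w) (hw0 : ∀ z, 0 ≤ w z)
    (hdecomp : μ = lebCircle.withDensity (fun z => ENNReal.ofReal (w z)) + μs)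
    (hsing : μs.MutuallySingular lebCircle) (hpos : ∀ᵐ z ∂lebCircle, 0 < w z) :
    ∃ f : ℂ → ℝ, Measurable f ∧ (∀ z, 0 ≤ f z) ∧ (∀ᵐ z ∂lebCircle, √(w z) * f z = 1) ∧
      Integrable (fun z => f z ^ 2) μ ∧ ∫ z, f z ^ 2 ∂μ = 1 := by
  obtain ⟨S, hS, hS1, hS2⟩ := hsing
  set f : ℂ → ℝ := S.indicator fun z => (√(w z))⁻¹ with hf
  have h1 : ∀ᵐ z ∂lebCircle, √(w z) * f z = 1 := by
    filter_upwards [hpos, (measure_eq_zero_iff_ae_notMem.1 hS2)] with z hz hzS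
    rw [hf, Set.indicator_of_mem (by simpa using hzS)]
    exact mul_inv_cancel₀ (Real.sqrt_pos.2 hz).ne'
  have h2 : ∀ᵐ z ∂lebCircle, (ENNReal.ofReal (w z)).toReal • f z ^ 2 = 1 := by
    filter_upwards [h1] with z hz
    rw [ENNReal.toReal_ofReal (hw0 z), smul_eq_mul]
    nth_rw 1 [← Real.sq_sqrt (hw0 z)]
    rw [← mul_pow, hz, one_pow]
  have h3 : (fun z => f z ^ 2) =ᵐ[μs] 0 := by
    filter_upwards [measure_eq_zero_iff_ae_notMem.1 hS1] with z hz
    simp [hf, Set.indicator_of_notMem hz]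
  have hlt : ∀ᵐ z ∂lebCircle, ENNReal.ofReal (w z) < ⊤ :=
    Eventually.of_forall fun z => ENNReal.ofReal_lt_top
  have hi1 : Integrable (fun z => f z ^ 2)
      (lebCircle.withDensity fun z => ENNReal.ofReal (w z)) := by
    rw [integrable_withDensity_iff_integrable_smul' hw.ennreal_ofReal hlt]
    exact (integrable_const (1 : ℝ)).congr (h2.mono fun z hz => hz.symm)
  have hi2 : Integrable (fun z => f z ^ 2) μs := (integrable_zero _ _ _).congr h3.symm
  refine ⟨f, hw.sqrt.inv.indicator hS, fun z => ?_, h1, ?_, ?_⟩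
  · exact Set.indicator_nonneg (fun z _ => by positivity) z
  · rw [hdecomp]
    exact hi1.add_measure hi2
  · rw [hdecomp, integral_add_measure hi1 hi2, integral_congr_ae h3,
      integral_withDensity_eq_integral_toReal_smul hw.ennreal_ofReal hlt, integral_congr_ae h2]
    simp

theorem exists_polynomial_sqrt_weight_approx (hμ : IsNontrivialOnCircle μ) (hw : Measurable w)
    (hw0 : ∀ z, 0 ≤ w z)
    (hdecomp : μ = lebCircle.withDensity (fun z => ENNReal.ofReal (w z)) + μs)
    (hsing : μs.MutuallySingular lebCircle) (hpos : ∀ᵐ z ∂lebCircle, 0 < w z)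
    {δ : ℝ} (hδ : 0 < δ) (hδ1 : δ ≤ 1) :
    ∃ P : Polynomial ℂ, ∫ z, ‖P.eval z‖ ^ 2 ∂μ ≤ 1 + δ ∧
      Integrable (fun z => (√(w z) * ‖P.eval z‖ - 1) ^ 2) lebCircle ∧
      ∫ z, (√(w z) * ‖P.eval z‖ - 1) ^ 2 ∂lebCircle ≤ δ ^ 2 := by
  have := hμ.prob
  obtain ⟨f, hfm, hf0, hf1, hfi, hfint⟩ := exists_sqrt_weight_inv hw hw0 hdecomp hsing hpos
  have hfc : Measurable fun z => (f z : ℂ) := by fun_prop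
  have hL : MemLp (fun z => (f z : ℂ)) 2 μ := by
    rw [memLp_two_iff_integrable_sq_norm hfc.aestronglyMeasurable]
    simpa using hfi
  set τ := δ / 4 with hτ
  have hτ0 : 0 < τ := by positivity
  obtain ⟨k, P, hP⟩ := exists_laurent_approx_memLp hμ.ae_norm hL (pow_pos hτ0 2)
  set q : ℂ → ℂ := fun z => (starRingEnd ℂ) z ^ k * P.eval z with hq
  have hqc : Continuous q := by fun_prop
  have hqn : ∀ z, ‖z‖ = 1 → ‖q z‖ = ‖P.eval z‖ := fun z hz => by simp [hq, hz]
  have hLq : MemLp q 2 μ := by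
    rw [memLp_two_iff_integrable_sq_norm hqc.aestronglyMeasurable]
    exact hμ.integrable_of_continuous (by fun_prop)
  have hdi : Integrable (fun z => ‖(f z : ℂ) - q z‖ ^ 2) μ :=
    (memLp_two_iff_integrable_sq_norm (hL.sub hLq).1).1 (hL.sub hLq)
  have hle : ∀ᵐ z ∂lebCircle,
      (√(w z) * ‖P.eval z‖ - 1) ^ 2 ≤ w z * ‖(f z : ℂ) - q z‖ ^ 2 := by
    filter_upwards [hf1, lebCircle_ae_norm] with z hz hz1
    have h1 : (√(w z) * ‖P.eval z‖ - 1) ^ 2 = w z * (f z - ‖q z‖) ^ 2 := by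
      nth_rw 2 [← Real.sq_sqrt (hw0 z)]
      rw [← hz, hqn z hz1]
      ring
    have h2 : |f z - ‖q z‖| ≤ ‖(f z : ℂ) - q z‖ := by
      have := abs_norm_sub_norm_le (f z : ℂ) (q z)
      rwa [Complex.norm_of_nonneg (hf0 z)] at this
    rw [h1, ← sq_abs (f z - _)]
    have := hw0 z
    gcongr
  have hwi := integrable_mul_weight hw hw0 hdecomp hdi
  have hint : Integrable (fun z => (√(w z) * ‖P.eval z‖ - 1) ^ 2) lebCircle := by
    refine hwi.mono' ?_ ?_
    · have hm : Measurable fun z => (√(w z) * ‖P.eval z‖ - 1) ^ 2 := by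
        have := hw.sqrt
        have : Measurable fun z => P.eval z := P.continuous.measurable
        fun_prop
      exact hm.aestronglyMeasurable
    · filter_upwards [hle] with z hz
      rwa [Real.norm_of_nonneg (by positivity)]
  refine ⟨P, ?_, hint, ?_⟩
  · calc ∫ z, ‖P.eval z‖ ^ 2 ∂μ
        ≤ ∫ z, ((1 + τ) * f z ^ 2 + (1 + τ⁻¹) * ‖(f z : ℂ) - q z‖ ^ 2) ∂μ := by
          refine integral_mono_ae (hμ.integrable_of_continuous (by fun_prop))
            ((hfi.const_mul _).fun_add (hdi.const_mul _)) ?_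
          filter_upwards [hμ.ae_norm] with z hz
          have h1 : ‖q z‖ ≤ f z + ‖(f z : ℂ) - q z‖ := by
            have := norm_sub_norm_le (q z) (f z : ℂ)
            rw [Complex.norm_of_nonneg (hf0 z), norm_sub_rev] at this
            linarith
          have h2 := pow_le_pow_left₀ (norm_nonneg _) h1 2
          rw [← hqn z hz]
          refine h2.trans ?_
          set d := ‖(f z : ℂ) - q z‖
          have h3 : τ * f z ^ 2 + τ⁻¹ * d ^ 2 - 2 * f z * d = τ * (f z - τ⁻¹ * d) ^ 2 := by
            field_simp
            ring
          have h4 : 0 ≤ τ * (f z - τ⁻¹ * d) ^ 2 := by positivity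
          linarith
      _ = (1 + τ) + (1 + τ⁻¹) * ∫ z, ‖(f z : ℂ) - q z‖ ^ 2 ∂μ := by
          rw [integral_add (hfi.const_mul _) (hdi.const_mul _), integral_const_mul,
            integral_const_mul, hfint, mul_one]
      _ ≤ (1 + τ) + (1 + τ⁻¹) * τ ^ 2 := by gcongr
      _ = 1 + 2 * τ + τ ^ 2 := by
          field_simp
          ring
      _ ≤ 1 + δ := by nlinarith
  · refine (integral_mono_ae hint hwi hle).trans
      ((integral_mul_weight_le hw hw0 hdecomp hdi fun z => by positivity).trans (hP.trans ?_))
    nlinarith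

theorem two_mul_one_sub_le {δ t y : ℝ} (hδ : 0 < δ) (hy : 0 ≤ y)
    (h : 4 * t ≤ y ^ 2) : 2 * (1 - ((2 * δ)⁻¹ * (t - 1) ^ 2 + δ / 2)) ≤ y := by
  have h1 : |t - 1| ≤ (2 * δ)⁻¹ * (t - 1) ^ 2 + δ / 2 := by
    rw [← sq_abs (t - 1)]
    have : (2 * δ)⁻¹ * |t - 1| ^ 2 + δ / 2 - |t - 1| = (2 * δ)⁻¹ * (|t - 1| - δ) ^ 2 := by
      field_simp
      ring
    have h2 : 0 ≤ (2 * δ)⁻¹ * (|t - 1| - δ) ^ 2 := by positivity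
    linarith
  have h2 : 2 * (1 - |t - 1|) ≤ y := by
    rcases le_total 1 t with h3 | h3
    · rw [abs_of_nonneg (by linarith)]
      nlinarith
    · rw [abs_of_nonpos (by linarith)]
      nlinarith
  linarith

theorem exists_forall_norm_verblunsky_le {Φ : ℕ → Polynomial ℂ} (hμ : IsNontrivialOnCircle μ)
    (hΦ : IsMonicOPUC μ Φ) (hw : Measurable w) (hw0 : ∀ z, 0 ≤ w z)
    (hdecomp : μ = lebCircle.withDensity (fun z => ENNReal.ofReal (w z)) + μs)
    (hsing : μs.MutuallySingular lebCircle) (hpos : ∀ᵐ z ∂lebCircle, 0 < w z)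
    {κ : ℝ} (hκ : 0 < κ) (hκ1 : κ ≤ 1) : ∃ N, ∀ n ≥ N, ‖verblunsky Φ n‖ ≤ 5 * κ := by
  have := hμ.prob
  set δ := κ ^ 2 with hδdef
  have hδ : 0 < δ := by positivity
  obtain ⟨P, hP1, hP2, hP3⟩ := exists_polynomial_sqrt_weight_approx hμ hw hw0 hdecomp hsing hpos
    hδ (pow_le_one₀ hκ.le hκ1)
  refine ⟨P.natDegree, fun n hn => ?_⟩
  have hN := hΦ.integral_norm_sq_pos hμ (n + 1)
  set g : ℂ → ℝ := fun z => (polyNormSq μ (Φ (n + 1)))⁻¹ * ‖(Φ (n + 1)).eval z‖ ^ 2 with hg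
  have hgi : Integrable g μ := hμ.integrable_of_continuous (by fun_prop)
  have hg0 : ∀ z, 0 ≤ g z := fun z => by positivity
  have hgint : ∫ z, g z ∂μ = 1 := by
    rw [hg, integral_const_mul]
    exact inv_mul_cancel₀ hN.ne'
  have hwg := integrable_mul_weight hw hw0 hdecomp hgi
  have hwg1 := integral_mul_weight_le hw hw0 hdecomp hgi hg0
  rw [hgint] at hwg1
  have hBi : Integrable (fun z => ‖P.eval z‖ ^ 2 * bernsteinSzego μ Φ n z) lebCircle :=
    integrable_of_continuousOn_sphere lebCircle_ae_norm
      (ContinuousOn.mul (by fun_prop) (continuousOn_bernsteinSzego hμ hΦ n))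
  have hB := integral_norm_sq_mul_bernsteinSzego hμ hΦ hn
  have hr := continuousOn_opucRatio hμ hΦ n
  have hri : Integrable (opucRatio μ Φ n) lebCircle :=
    integrable_of_continuousOn_sphere lebCircle_ae_norm hr
  have hxi : Integrable (fun z => √(opucRatio μ Φ n z)) lebCircle :=
    integrable_of_continuousOn_sphere lebCircle_ae_norm hr.sqrt
  have hr0 : ∀ z, ‖z‖ = 1 → 0 ≤ opucRatio μ Φ n z := fun z hz =>
    (div_pos (bernsteinSzego_pos hμ hΦ _ hz) (bernsteinSzego_pos hμ hΦ _ hz)).le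
  have hx : 1 - 5 / 2 * δ ≤ ∫ z, √(opucRatio μ Φ n z) ∂lebCircle := by
    have h : ∫ z, 2 * (1 - ((2 * δ)⁻¹ * (√(w z) * ‖P.eval z‖ - 1) ^ 2 + δ / 2)) ∂lebCircle ≤
        ∫ z, (√(opucRatio μ Φ n z) + (1 / 2 * (w z * g z) +
          1 / 2 * (‖P.eval z‖ ^ 2 * bernsteinSzego μ Φ n z))) ∂lebCircle := by
      refine integral_mono_ae
        (((integrable_const _).sub ((hP2.const_mul _).fun_add (integrable_const _))).const_mul _)
        (hxi.fun_add ((hwg.const_mul _).fun_add (hBi.const_mul _))) ?_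
      filter_upwards [lebCircle_ae_norm] with z hz
      have hp := bernsteinSzego_pos hμ hΦ n hz
      have hF := norm_pos_iff.2 (hΦ.eval_ne_zero hμ (n + 1) hz)
      set A := w z * g z with hA
      set B := ‖P.eval z‖ ^ 2 * bernsteinSzego μ Φ n z with hB
      have hA0 : 0 ≤ A := mul_nonneg (hw0 z) (hg0 z)
      have hB0 : 0 ≤ B := by positivity
      have hsq : (√(w z) * ‖P.eval z‖) ^ 2 = A * B * √(opucRatio μ Φ n z) ^ 2 := by
        rw [mul_pow, Real.sq_sqrt (hw0 z), Real.sq_sqrt (hr0 z hz), hA, hB, hg, opucRatio]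
        nth_rw 2 [bernsteinSzego]
        field_simp
      have hx0 := Real.sqrt_nonneg (opucRatio μ Φ n z)
      set x := √(opucRatio μ Φ n z)
      have ht : √(w z) * ‖P.eval z‖ ≤ (A + B) / 2 * x := by
        refine le_of_sq_le_sq ?_ (by positivity)
        rw [hsq, mul_pow]
        gcongr
        nlinarith [sq_nonneg (A - B)]
      refine two_mul_one_sub_le hδ (by positivity) ?_
      nlinarith [sq_nonneg (x - (A + B) / 2)]
    rw [integral_const_mul, integral_sub (integrable_const _)
        ((hP2.const_mul _).fun_add (integrable_const _)),
      integral_add (hP2.const_mul _) (integrable_const _), integral_const_mul,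
      integral_add hxi ((hwg.const_mul _).fun_add (hBi.const_mul _)),
      integral_add (hwg.const_mul _) (hBi.const_mul _), integral_const_mul, integral_const_mul,
      hB] at h
    simp only [integral_const, probReal_univ, smul_eq_mul, one_mul] at h
    have h1 : (2 * δ)⁻¹ * ∫ z, (√(w z) * ‖P.eval z‖ - 1) ^ 2 ∂lebCircle ≤ δ / 2 := by
      calc _ ≤ (2 * δ)⁻¹ * δ ^ 2 := by gcongr
        _ = δ / 2 := by field_simp
    linarith
  refine (norm_verblunsky_le hμ hΦ n).trans ?_
  have hri1 := integral_opucRatio hμ hΦ n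
  have hI : Integrable (fun z => opucRatio μ Φ n z + 1 - 2 * √(opucRatio μ Φ n z)) lebCircle :=
    (hri.fun_add (integrable_const 1)).sub (hxi.const_mul 2)
  calc ∫ z, |opucRatio μ Φ n z - 1| ∂lebCircle
      ≤ ∫ z, ((2 * κ)⁻¹ * (opucRatio μ Φ n z + 1 - 2 * √(opucRatio μ Φ n z)) +
          κ * (opucRatio μ Φ n z + 1)) ∂lebCircle := by
        refine integral_mono_ae (hri.sub (integrable_const _)).abs
          ((hI.const_mul _).fun_add ((hri.fun_add (integrable_const _)).const_mul _)) ?_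
        filter_upwards [lebCircle_ae_norm] with z hz
        have hs := Real.sq_sqrt (hr0 z hz)
        have hx0 := Real.sqrt_nonneg (opucRatio μ Φ n z)
        set x := √(opucRatio μ Φ n z)
        rw [← hs]
        have h1 : |x ^ 2 - 1| = |x - 1| * (x + 1) := by
          rw [← abs_of_nonneg (show 0 ≤ x + 1 by positivity), ← abs_mul]
          congr 1
          ring
        rw [h1, show x ^ 2 + 1 - 2 * x = |x - 1| ^ 2 by rw [sq_abs]; ring]
        have h2 : (2 * κ)⁻¹ * |x - 1| ^ 2 + κ / 2 * (x + 1) ^ 2 - |x - 1| * (x + 1)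
            = (2 * κ)⁻¹ * (|x - 1| - κ * (x + 1)) ^ 2 := by
          field_simp
          ring
        have h3 : 0 ≤ (2 * κ)⁻¹ * (|x - 1| - κ * (x + 1)) ^ 2 := by positivity
        nlinarith [mul_nonneg hκ.le (sq_nonneg (x - 1))]
    _ = (2 * κ)⁻¹ * (2 - 2 * ∫ z, √(opucRatio μ Φ n z) ∂lebCircle) + κ * 2 := by
        rw [integral_add (hI.const_mul _) ((hri.fun_add (integrable_const _)).const_mul _),
          integral_const_mul, integral_const_mul, integral_sub (hri.fun_add (integrable_const _))
            (hxi.const_mul _), integral_add hri (integrable_const _), integral_const_mul, hri1]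
        simp only [integral_const, probReal_univ, smul_eq_mul, one_mul]
        ring
    _ ≤ (2 * κ)⁻¹ * (5 * δ) + κ * 2 := by
        gcongr
        linarith
    _ ≤ 5 * κ := by
        have : (2 * κ)⁻¹ * (5 * δ) = 5 / 2 * κ := by
          rw [hδdef]
          field_simp
        linarith

end Rakhmanov

/-- Rakhmanov's theorem: if the a.c. weight `w` of `μ` is positive
Lebesgue-a.e. on the circle, then `α_n(dμ) → 0`. -/
theorem stmt17 (μ : Measure ℂ) (hμ : IsNontrivialOnCircle μ)
    (Φ : ℕ → Polynomial ℂ) (hΦ : IsMonicOPUC μ Φ)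
    (w : ℂ → ℝ) (hw : Measurable w) (hw0 : ∀ z, 0 ≤ w z)
    (μs : Measure ℂ)
    (hdecomp : μ = lebCircle.withDensity (fun z => ENNReal.ofReal (w z)) + μs)
    (hsing : μs.MutuallySingular lebCircle)
    (hpos : ∀ᵐ z ∂lebCircle, 0 < w z) :
    Tendsto (fun n => verblunsky Φ n) atTop (nhds 0) := by
  rw [Metric.tendsto_atTop]
  intro ε hε
  set κ := min (ε / 10) 1 with hκ
  have hκ0 : 0 < κ := by positivity
  obtain ⟨N, hN⟩ := exists_forall_norm_verblunsky_le hμ hΦ hw hw0 hdecomp hsing hpos hκ0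
    (min_le_right _ _)
  refine ⟨N, fun n hn => ?_⟩
  rw [dist_zero_right]
  have h1 := hN n hn
  have h2 : κ ≤ ε / 10 := min_le_left _ _
  linarith

end
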